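/- arXiv:2112.12443 — 4 statements merged into one kernel-verified Lean document; each statement's English description precedes it below -/
import Mathlib

section
/- Let (p_n) ⊂ (1,2) be a nonincreasing sequence with p_n → 1. Then for every c ∈ ℓ² there exists a sequence (c_n) in ℓ² converging in ℓ²-norm to c such that limsup_{n→∞} R̆_{p_n}(c_n) ≤ R̆_1(c) in [0,∞]. (Existence of recovery sequences for the Γ-convergence of R̆_{p_n} to R̆_1 with respect to the ℓ² topology.) -/
open scoped ENNReal

/-- The extended-real-valued functional `R̆_r : ℓ² → [0,∞]`,
`R̆_r(c) = (1/r) ∑_λ |c_λ|^r` if the sum is finite (i.e. `c ∈ ℓ^r`) and `∞` otherwise.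
(Here the `ℝ≥0∞`-valued `tsum` is `∞` exactly when `fun λ => |c λ| ^ r` is not summable.) -/
noncomputable def Rbreve (r : ℝ) (c : ℕ → ℝ) : ℝ≥0∞ :=
  ENNReal.ofReal (1 / r) * ∑' i, ENNReal.ofReal (|c i| ^ r)

theorem Rbreve_eq_ofReal {r : ℝ} (hr : 0 < r) {c : ℕ → ℝ}
    (hc : Summable fun i => |c i| ^ r) :
    Rbreve r c = ENNReal.ofReal (1 / r * ∑' i, |c i| ^ r) := by
  rw [Rbreve, ENNReal.ofReal_mul (by positivity),
    ENNReal.ofReal_tsum_of_nonneg (fun i => by positivity) hc]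

theorem Rbreve_eq_top {r : ℝ} (hr : 0 < r) {c : ℕ → ℝ}
    (hc : ¬ Summable fun i => |c i| ^ r) : Rbreve r c = ⊤ := by
  have htop : ∑' i, ENNReal.ofReal (|c i| ^ r) = ⊤ := by
    by_contra h
    refine hc ((ENNReal.summable_toReal h).congr fun i => ?_)
    exact ENNReal.toReal_ofReal (by positivity)
  rw [Rbreve, htop, ENNReal.mul_top]
  simpa using hr

theorem abs_rpow_le_abs_add_sq {r : ℝ} (h1 : 1 ≤ r) (h2 : r ≤ 2) (x : ℝ) :
    |x| ^ r ≤ |x| + x ^ 2 := by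
  rcases le_total |x| 1 with hx | hx
  · have := Real.rpow_le_self_of_le_one (abs_nonneg x) hx h1
    nlinarith [sq_nonneg x]
  · have h := Real.rpow_le_rpow_of_exponent_le hx h2
    rw [Real.rpow_two, sq_abs] at h
    linarith [abs_nonneg x]

theorem tendsto_Rbreve_one {p : ℕ → ℝ} (hp : ∀ n, 1 < p n ∧ p n < 2)
    (hplim : Filter.Tendsto p Filter.atTop (nhds 1)) {c : ℕ → ℝ}
    (hc2 : Summable fun i => (c i) ^ 2) (hc1 : Summable fun i => |c i| ^ (1 : ℝ)) :
    Filter.Tendsto (fun n => Rbreve (p n) c) Filter.atTop (nhds (Rbreve 1 c)) := by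
  have hbound : Summable fun i => |c i| + c i ^ 2 := by
    simpa only [Real.rpow_one] using hc1.add hc2
  have hle (n i : ℕ) : |c i| ^ p n ≤ |c i| + c i ^ 2 :=
    abs_rpow_le_abs_add_sq (hp n).1.le (hp n).2.le (c i)
  have hsum (n : ℕ) : Summable fun i => |c i| ^ p n :=
    hbound.of_nonneg_of_le (fun i => by positivity) (hle n)
  have hlim : Filter.Tendsto (fun n => ∑' i, |c i| ^ p n) Filter.atTop
      (nhds (∑' i, |c i| ^ (1 : ℝ))) := by
    refine tendsto_tsum_of_dominated_convergence hbound
      (fun i => (Real.continuousAt_const_rpow' one_ne_zero).tendsto.comp hplim) (Filter.Eventually.of_forall fun n i => ?_)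
    rw [Real.norm_of_nonneg (by positivity)]
    exact hle n i
  rw [Rbreve_eq_ofReal one_pos hc1]
  simp_rw [fun n => Rbreve_eq_ofReal (one_pos.trans (hp n).1) (hsum n)]
  exact ENNReal.tendsto_ofReal ((tendsto_const_nhds.div hplim one_ne_zero).mul hlim)

/-- recovery sequences for the Γ-convergence `R̆_{p_n} → R̆_1`, Theorem 5.2(ii).
Let `(p n) ⊂ (1,2)` be nonincreasing with `p n → 1`.  Then for every `c ∈ ℓ²` there is a
sequence `(cseq n)` in `ℓ²` converging to `c` in `ℓ²`-norm such that
`limsup_n R̆_{p_n}(cseq n) ≤ R̆_1(c)` in `[0,∞]`. -/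
theorem stmt2 (p : ℕ → ℝ) (hmono : Antitone p) (hp : ∀ n, 1 < p n ∧ p n < 2)
    (hplim : Filter.Tendsto p Filter.atTop (nhds 1))
    (c : ℕ → ℝ) (hc2 : Summable fun i => (c i) ^ 2) :
    ∃ cseq : ℕ → ℕ → ℝ,
      (∀ n, Summable fun i => (cseq n i) ^ 2) ∧
      Filter.Tendsto (fun n => ∑' i, (cseq n i - c i) ^ 2) Filter.atTop (nhds 0) ∧
      Filter.limsup (fun n => Rbreve (p n) (cseq n)) Filter.atTop ≤ Rbreve 1 c := by
  refine ⟨fun _ => c, fun _ => hc2, by simp, ?_⟩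
  by_cases hc1 : Summable fun i => |c i| ^ (1 : ℝ)
  · exact (tendsto_Rbreve_one hp hplim hc2 hc1).limsup_eq.le
  · rw [Rbreve_eq_top one_pos hc1]
    exact le_top
end

section
/- Let X be a real normed space, 1 < p < 2 with Hölder conjugate q = p/(p−1), and let m = (m_λ)_{λ∈ℕ} be strictly positive weights. Let S : X → ℓ^p_m and T : ℓ^p_m → X be bounded linear operators with T ∘ S = id_X, and set R(f) = (1/p) ∑_λ m_λ^p |(Sf)_λ|^p for f ∈ X. Then for every continuous linear functional y on X, sup_{f∈X} ( y(f) − R(f) ) ≤ (1/q) ∑_λ m_λ^{−q} |y(T e_λ)|^q, where (e_λ) denotes the canonical unit sequences. -/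
open scoped ENNReal

open Filter Topology

/-- Young's inequality for a product of two reals, weighted by a positive number. -/
theorem mul_le_weighted_young {p q : ℝ} (hpq : p.HolderConjugate q) {w : ℝ} (hw : 0 < w)
    (a b : ℝ) :
    a * b ≤ (1 / p) * (w ^ p * |a| ^ p) + (1 / q) * (w ^ (-q) * |b| ^ q) := by
  have h := Real.young_inequality (w * a) (w⁻¹ * b) hpq
  rw [abs_mul, abs_mul, abs_of_pos hw, abs_of_pos (inv_pos.2 hw),
    Real.mul_rpow hw.le (abs_nonneg a), Real.mul_rpow (inv_pos.2 hw).le (abs_nonneg b),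
    Real.inv_rpow hw.le, ← Real.rpow_neg hw.le] at h
  calc a * b = w * a * (w⁻¹ * b) := by field_simp
    _ ≤ _ := h
    _ = _ := by ring

/-- A linear map on sequences that is bounded for a weighted `ℓ^p` norm sends the finite
truncations of a weighted `p`-summable sequence to a sequence converging to its image. -/
theorem tendsto_map_truncation {X : Type*} [NormedAddCommGroup X] [NormedSpace ℝ X]
    {p : ℝ} (hp : 0 < p) (w : ℕ → ℝ) (T : (ℕ → ℝ) →ₗ[ℝ] X)
    (hT : ∃ C : ℝ, ∀ c : ℕ → ℝ, Summable (fun i => w i * |c i| ^ p) →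
        ‖T c‖ ≤ C * (∑' i, w i * |c i| ^ p) ^ (1 / p))
    (c : ℕ → ℝ) (hc : Summable fun i => w i * |c i| ^ p) :
    Tendsto (fun N => ∑ i ∈ Finset.range N, c i • T (Pi.single i 1)) atTop (𝓝 (T c)) := by
  obtain ⟨C, hC⟩ := hT
  set a : ℕ → ℝ := fun i => w i * |c i| ^ p with ha
  have bound (N : ℕ) : ‖(∑ i ∈ Finset.range N, c i • T (Pi.single i 1)) - T c‖
      ≤ C * (∑' i, a i - ∑ i ∈ Finset.range N, a i) ^ (1 / p) := by
    set d : ℕ → ℝ := fun i => if i ∈ Finset.range N then 0 else c i with hd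
    have trunc : (∑ i ∈ Finset.range N, c i • (Pi.single i 1 : ℕ → ℝ)) = c - d := by
      ext j
      by_cases hj : j < N <;> simp [hd, Finset.sum_apply, Pi.single_apply, hj]
    have sum_trunc : HasSum (fun i => if i ∈ Finset.range N then a i else 0)
        (∑ i ∈ Finset.range N, a i) := by
      rw [← Finset.sum_congr rfl fun i hi => if_pos hi]
      exact hasSum_sum_of_ne_finset_zero fun i hi => if_neg hi
    have tail : HasSum (fun i => w i * |d i| ^ p)
        (∑' i, a i - ∑ i ∈ Finset.range N, a i) := by
      have split : (fun i => w i * |d i| ^ p) =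
          fun i => a i - if i ∈ Finset.range N then a i else 0 := by
        funext i
        by_cases hi : i < N <;> simp [hd, ha, hi, Real.zero_rpow hp.ne']
      rw [split]
      exact hc.hasSum.sub sum_trunc
    have map_trunc : (∑ i ∈ Finset.range N, c i • T (Pi.single i 1)) - T c = -T d := by
      simp_rw [← map_smul, ← map_sum, trunc, map_sub]
      abel
    rw [map_trunc, norm_neg, ← tail.tsum_eq]
    exact hC d tail.summable
  rw [tendsto_iff_norm_sub_tendsto_zero]
  refine squeeze_zero (fun _ => norm_nonneg _) bound ?_
  have tail_zero : Tendsto (fun N => ∑' i, a i - ∑ i ∈ Finset.range N, a i) atTop (𝓝 0) := by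
    simpa using hc.hasSum.tendsto_sum_nat.const_sub (∑' i, a i)
  have hp' : 0 < 1 / p := one_div_pos.2 hp
  simpa [Real.zero_rpow (inv_pos.2 hp).ne'] using
    (tail_zero.rpow_const (Or.inr hp'.le)).const_mul C

/-- bound on the Fenchel conjugate of the frame penalty.
`X` a real normed space, `1 < p < 2`, `q = p/(p-1)`, `m` strictly positive weights.
`S : X → ℓ^p_m` and `T : ℓ^p_m → X` are bounded linear operators with `T ∘ S = id_X`
(here `S`, `T` are encoded as linear maps on sequences, with the `ℓ^p_m`-boundedness
stated explicitly), and `R(f) = (1/p) ∑_λ m_λ^p |(Sf)_λ|^p`.  Then for every continuous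
linear functional `y` on `X`,
`sup_{f ∈ X} (y(f) − R(f)) ≤ (1/q) ∑_λ m_λ^{-q} |y(T e_λ)|^q`, the inequality being in
`[0,∞]` (the supremum is expressed by quantifying over `f`). -/
theorem stmt4 (p q : ℝ) (hp1 : 1 < p) (hp2 : p < 2) (hq : q = p / (p - 1))
    (m : ℕ → ℝ) (hm : ∀ i, 0 < m i)
    (X : Type) [NormedAddCommGroup X] [NormedSpace ℝ X]
    (S : X →ₗ[ℝ] (ℕ → ℝ)) (T : (ℕ → ℝ) →ₗ[ℝ] X)
    (hSmem : ∀ f, Summable fun i => (m i) ^ p * |S f i| ^ p)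
    (hSbdd : ∃ C : ℝ, ∀ f, (∑' i, (m i) ^ p * |S f i| ^ p) ^ (1 / p) ≤ C * ‖f‖)
    (hTbdd : ∃ C : ℝ, ∀ c : ℕ → ℝ, Summable (fun i => (m i) ^ p * |c i| ^ p) →
        ‖T c‖ ≤ C * (∑' i, (m i) ^ p * |c i| ^ p) ^ (1 / p))
    (hTS : ∀ f, T (S f) = f)
    (y : X →L[ℝ] ℝ) :
    ∀ f : X,
      ENNReal.ofReal (y f - (1 / p) * ∑' i, (m i) ^ p * |S f i| ^ p)
        ≤ ENNReal.ofReal (1 / q) *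
            ∑' i, ENNReal.ofReal ((m i) ^ (-q) * |y (T (Pi.single i 1))| ^ q) := by
  intro f
  have hpq : p.HolderConjugate q := by
    rw [hq]
    exact Real.HolderConjugate.conjExponent hp1
  have hq0 : 0 ≤ 1 / q := (one_div_pos.2 hpq.symm.pos).le
  have hp0 : 0 ≤ 1 / p := (one_div_pos.2 hpq.pos).le
  have lim := (y.continuous.tendsto _).comp
    (tendsto_map_truncation hpq.pos (fun i => m i ^ p) T hTbdd (S f) (hSmem f))
  rw [hTS] at lim
  refine le_of_tendsto' (ENNReal.tendsto_ofReal
    (lim.sub_const ((1 / p) * ∑' i, (m i) ^ p * |S f i| ^ p))) fun N => ?_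
  have nonneg (i : ℕ) : 0 ≤ (m i) ^ (-q) * |y (T (Pi.single i 1))| ^ q :=
    mul_nonneg (Real.rpow_nonneg (hm i).le _) (Real.rpow_nonneg (abs_nonneg _) _)
  calc _ ≤ ENNReal.ofReal ((1 / q) *
        ∑ i ∈ Finset.range N, (m i) ^ (-q) * |y (T (Pi.single i 1))| ^ q) := by
        refine ENNReal.ofReal_le_ofReal ?_
        have young := Finset.sum_le_sum fun i (_ : i ∈ Finset.range N) =>
          mul_le_weighted_young hpq (hm i) (S f i) (y (T (Pi.single i 1)))
        have partial_le := mul_le_mul_of_nonneg_left ((hSmem f).sum_le_tsum (Finset.range N)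
          fun i _ => mul_nonneg (Real.rpow_nonneg (hm i).le p)
            (Real.rpow_nonneg (abs_nonneg (S f i)) p)) hp0
        rw [Finset.sum_add_distrib, ← Finset.mul_sum, ← Finset.mul_sum] at young
        simp only [Function.comp_apply, map_sum, map_smul, smul_eq_mul]
        linarith
    _ ≤ _ := by
        rw [ENNReal.ofReal_mul hq0, ENNReal.ofReal_sum_of_nonneg fun i _ => nonneg i]
        gcongr
        exact ENNReal.sum_le_tsum _
end

section
/- Let 1 < p < 2. There exists a constant C > 0 depending only on p such that for all f, g ∈ ℓ^p and every γ > 0: (γ^p/p) ‖f − g‖_p^p ≤ C (1 − p/2) γ^{2p/(2−p)} max{ (1/p)‖f‖_p^p , (1/p)‖g‖_p^p } + (p/2) D_R(f, g). -/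
/-- The duality map `t ↦ sign t * |t| ^ q` agrees with `t ↦ t ^ q` on the nonnegative reals. -/
theorem sign_mul_abs_rpow_of_nonneg {q a : ℝ} (hq : q ≠ 0) (ha : 0 ≤ a) :
    Real.sign a * |a| ^ q = a ^ q := by
  rcases ha.eq_or_lt with rfl | h
  · simp [Real.zero_rpow hq]
  · rw [Real.sign_of_pos h, abs_of_pos h, one_mul]

theorem sign_mul_abs_rpow_neg (q a : ℝ) :
    Real.sign (-a) * |-a| ^ q = -(Real.sign a * |a| ^ q) := by
  rw [Real.sign_neg, abs_neg, neg_mul]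

theorem abs_sign_mul_abs_rpow_le (q a : ℝ) : |Real.sign a * |a| ^ q| ≤ |a| ^ q := by
  have h : 0 ≤ |a| ^ q := Real.rpow_nonneg (abs_nonneg a) q
  rcases Real.sign_apply_eq a with h' | h' | h' <;> simp [h', abs_of_nonneg h, h]

/-- Quantitative strong monotonicity of the duality map `t ↦ sign t * |t| ^ (p - 1)`. -/
theorem mul_sub_sq_le_bregman_mul_max_rpow {p : ℝ} (hp1 : 1 < p) (hp2 : p < 2) (a b : ℝ) :
    (p - 1) / 2 * (a - b) ^ 2 ≤
      (Real.sign a * |a| ^ (p - 1) - Real.sign b * |b| ^ (p - 1)) * (a - b) *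
        max |a| |b| ^ (2 - p) := by
  have hq : p - 1 ≠ 0 := by linarith
  wlog hab : |b| ≤ |a| generalizing a b
  · have := this b a (le_of_not_ge hab)
    rw [max_comm] at this
    linarith
  wlog ha : 0 ≤ a generalizing a b
  · have := this (-a) (-b) (by simpa using hab) (by linarith)
    simp only [Real.sign_neg, abs_neg] at this
    linarith
  rw [max_eq_left hab, sign_mul_abs_rpow_of_nonneg hq ha, abs_of_nonneg ha]
  rw [abs_of_nonneg ha] at hab
  have hmul : a ^ (p - 1) * a ^ (2 - p) = a := by
    rw [← Real.rpow_add_of_nonneg ha (by linarith) (by linarith)]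
    norm_num
  have ha' : 0 ≤ a ^ (2 - p) := Real.rpow_nonneg ha _
  rcases le_total 0 b with hb | hb
  · rw [sign_mul_abs_rpow_of_nonneg hq hb]
    rw [abs_of_nonneg hb] at hab
    have h := Real.geom_mean_le_arith_mean2_weighted (w₁ := p - 1) (w₂ := 2 - p)
      (by linarith) (by linarith) hb ha (by ring)
    nlinarith [mul_le_mul_of_nonneg_right h (sub_nonneg.2 hab),
      mul_nonneg (sub_nonneg.2 hp1.le) (sq_nonneg (a - b))]
  · obtain ⟨s, rfl⟩ : ∃ s, b = -s := ⟨-b, by ring⟩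
    have hs : 0 ≤ s := by linarith
    rw [sign_mul_abs_rpow_neg, sign_mul_abs_rpow_of_nonneg hq hs]
    rw [abs_neg, abs_of_nonneg hs] at hab
    have h1 : 0 ≤ s ^ (p - 1) * a ^ (2 - p) := mul_nonneg (Real.rpow_nonneg hs _) ha'
    have h2 : (p - 1) / 2 * (a + s) ≤ a := by nlinarith
    have h3 : (a ^ (p - 1) - -s ^ (p - 1)) * (a - -s) * a ^ (2 - p)
        = (a ^ (p - 1) * a ^ (2 - p) + s ^ (p - 1) * a ^ (2 - p)) * (a + s) := by ring
    rw [h3, hmul]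
    nlinarith [mul_nonneg h1 (add_nonneg ha hs),
      mul_le_mul_of_nonneg_right h2 (add_nonneg ha hs)]

theorem bregman_nonneg {p : ℝ} (hp : 1 < p) (a b : ℝ) :
    0 ≤ (Real.sign a * |a| ^ (p - 1) - Real.sign b * |b| ^ (p - 1)) * (a - b) := by
  have hq : p - 1 ≠ 0 := by linarith
  have hq' : 0 ≤ p - 1 := by linarith
  wlog hab : b ≤ a generalizing a b
  · have := this b a (le_of_not_ge hab)
    linarith
  refine mul_nonneg (sub_nonneg.2 ?_) (sub_nonneg.2 hab)
  rcases le_total 0 b with hb | hb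
  · rw [sign_mul_abs_rpow_of_nonneg hq hb, sign_mul_abs_rpow_of_nonneg hq (hb.trans hab)]
    exact Real.rpow_le_rpow hb hab hq'
  · have hb' := sign_mul_abs_rpow_neg (p - 1) b
    rw [sign_mul_abs_rpow_of_nonneg hq (neg_nonneg.2 hb)] at hb'
    rcases le_total 0 a with ha | ha
    · rw [sign_mul_abs_rpow_of_nonneg hq ha]
      linarith [Real.rpow_nonneg ha (p - 1), Real.rpow_nonneg (neg_nonneg.2 hb) (p - 1)]
    · have ha' := sign_mul_abs_rpow_neg (p - 1) a
      rw [sign_mul_abs_rpow_of_nonneg hq (neg_nonneg.2 ha)] at ha'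
      linarith [Real.rpow_le_rpow (neg_nonneg.2 ha) (neg_le_neg hab) hq']

theorem max_abs_rpow_le_add {p : ℝ} (a b : ℝ) :
    max |a| |b| ^ p ≤ |a| ^ p + |b| ^ p := by
  have ha := Real.rpow_nonneg (abs_nonneg a) p
  have hb := Real.rpow_nonneg (abs_nonneg b) p
  rcases max_choice |a| |b| with h | h <;> rw [h] <;> linarith

theorem bregman_le {p : ℝ} (hp : 1 < p) (a b : ℝ) :
    (Real.sign a * |a| ^ (p - 1) - Real.sign b * |b| ^ (p - 1)) * (a - b) ≤
      4 * (|a| ^ p + |b| ^ p) := by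
  set M := max |a| |b|
  have hM0 : 0 ≤ M := (abs_nonneg a).trans (le_max_left _ _)
  have hq : 0 ≤ p - 1 := by linarith
  have h1 : |Real.sign a * |a| ^ (p - 1) - Real.sign b * |b| ^ (p - 1)| ≤ 2 * M ^ (p - 1) := by
    linarith [abs_sub (Real.sign a * |a| ^ (p - 1)) (Real.sign b * |b| ^ (p - 1)),
      abs_sign_mul_abs_rpow_le (p - 1) a, abs_sign_mul_abs_rpow_le (p - 1) b,
      Real.rpow_le_rpow (abs_nonneg a) (le_max_left |a| |b|) hq,
      Real.rpow_le_rpow (abs_nonneg b) (le_max_right |a| |b|) hq]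
  have h2 : |a - b| ≤ 2 * M := by
    linarith [abs_sub a b, le_max_left |a| |b|, le_max_right |a| |b|]
  have hmul : M ^ (p - 1) * M = M ^ p := by
    nth_rw 2 [← Real.rpow_one M]
    rw [← Real.rpow_add_of_nonneg hM0 hq zero_le_one]
    norm_num
  calc _ ≤ _ := le_abs_self _
    _ = _ := abs_mul _ _
    _ ≤ (2 * M ^ (p - 1)) * (2 * M) := mul_le_mul h1 h2 (abs_nonneg _) (by positivity)
    _ = 4 * M ^ p := by rw [← hmul]; ring
    _ ≤ _ := by linarith [max_abs_rpow_le_add (p := p) a b]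

/-- The scalar Xu–Roach-type inequality. -/
theorem rpow_abs_sub_le_add_bregman {p γ : ℝ} (hp1 : 1 < p) (hp2 : p < 2) (hγ : 0 < γ)
    (a b : ℝ) :
    γ ^ p / p * |a - b| ^ p ≤
      (1 - p / 2) * ((((p - 1) / 2) ^ (-(p / 2)) / p) ^ (2 / (2 - p)) *
        γ ^ (2 * p / (2 - p)) * (|a| ^ p + |b| ^ p)) +
      p / 2 * ((Real.sign a * |a| ^ (p - 1) - Real.sign b * |b| ^ (p - 1)) * (a - b)) := by
  have hD := bregman_nonneg hp1 a b
  have hkey := mul_sub_sq_le_bregman_mul_max_rpow hp1 hp2 a b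
  have hMle := max_abs_rpow_le_add (p := p) a b
  set D := (Real.sign a * |a| ^ (p - 1) - Real.sign b * |b| ^ (p - 1)) * (a - b)
  set M := max |a| |b|
  have hM : 0 ≤ M := (abs_nonneg a).trans (le_max_left _ _)
  set c := (p - 1) / 2 with hc_def
  have hc : 0 < c := by rw [hc_def]; linarith
  have hp : 0 < p := by linarith
  have hp' : 2 - p ≠ 0 := by linarith
  have hp'' : 0 ≤ 1 - p / 2 := by linarith
  set K := (c ^ (-(p / 2)) / p) ^ (2 / (2 - p)) with hK
  have hK0 : 0 ≤ K := by positivity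
  set X := K * γ ^ (2 * p / (2 - p)) * M ^ p with hX
  have hX0 : 0 ≤ X := by positivity
  have hXpow : X ^ (1 - p / 2) = c ^ (-(p / 2)) / p * γ ^ p * M ^ ((2 - p) * (p / 2)) := by
    rw [hX, Real.mul_rpow (by positivity) (by positivity),
      Real.mul_rpow (by positivity) (by positivity), hK,
      ← Real.rpow_mul (by positivity), ← Real.rpow_mul hγ.le, ← Real.rpow_mul hM]
    have e1 : 2 / (2 - p) * (1 - p / 2) = 1 := by field_simp
    have e2 : 2 * p / (2 - p) * (1 - p / 2) = p := by field_simp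
    have e3 : p * (1 - p / 2) = (2 - p) * (p / 2) := by ring
    rw [e1, e2, e3, Real.rpow_one]
  have hpow : c ^ (p / 2) * |a - b| ^ p ≤ D ^ (p / 2) * M ^ ((2 - p) * (p / 2)) := by
    have h := Real.rpow_le_rpow (by positivity) hkey (by positivity : 0 ≤ p / 2)
    rw [Real.mul_rpow hc.le (sq_nonneg _), Real.mul_rpow hD (by positivity),
      ← Real.rpow_mul hM, ← sq_abs, ← Real.rpow_natCast, ← Real.rpow_mul (abs_nonneg _)] at h
    have e : ((2 : ℕ) : ℝ) * (p / 2) = p := by push_cast; ring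
    rwa [e] at h
  have hcc : c ^ (-(p / 2)) * c ^ (p / 2) = 1 := by
    rw [← Real.rpow_add hc, neg_add_cancel, Real.rpow_zero]
  calc γ ^ p / p * |a - b| ^ p
      = c ^ (-(p / 2)) / p * γ ^ p * (c ^ (p / 2) * |a - b| ^ p) := by
        linear_combination (-(γ ^ p / p * |a - b| ^ p)) * hcc
    _ ≤ c ^ (-(p / 2)) / p * γ ^ p * (D ^ (p / 2) * M ^ ((2 - p) * (p / 2))) := by gcongr
    _ = D ^ (p / 2) * X ^ (1 - p / 2) := by rw [hXpow]; ring
    _ ≤ p / 2 * D + (1 - p / 2) * X :=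
        Real.geom_mean_le_arith_mean2_weighted (by positivity) hp'' hD hX0 (by ring)
    _ ≤ p / 2 * D + (1 - p / 2) * (K * γ ^ (2 * p / (2 - p)) * (|a| ^ p + |b| ^ p)) := by
        rw [hX]
        gcongr
    _ = _ := add_comm _ _


/-- Xu–Roach-type inequality, Lemma 2.3 of the paper, for `ℓ^p`.
Let `1 < p < 2`.  There is `C > 0` depending only on `p` such that for all `f, g ∈ ℓ^p`
and every `γ > 0`:
`(γ^p/p)‖f − g‖_p^p ≤ C (1 − p/2) γ^{2p/(2−p)} max{(1/p)‖f‖_p^p, (1/p)‖g‖_p^p}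
  + (p/2) D_R(f, g)`,
where `D_R(f,g) = ∑_λ (sign(f_λ)|f_λ|^{p−1} − sign(g_λ)|g_λ|^{p−1})(f_λ − g_λ)` is the
symmetric Bregman distance of `R(f) = (1/p)∑_λ |f_λ|^p`. -/
theorem stmt11 (p : ℝ) (hp1 : 1 < p) (hp2 : p < 2) :
    ∃ C : ℝ, 0 < C ∧
      ∀ f g : ℕ → ℝ,
        Summable (fun i => |f i| ^ p) → Summable (fun i => |g i| ^ p) →
        ∀ γ : ℝ, 0 < γ →
          (γ ^ p / p) * ∑' i, |f i - g i| ^ p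
            ≤ C * (1 - p / 2) * γ ^ (2 * p / (2 - p)) *
                max ((1 / p) * ∑' i, |f i| ^ p) ((1 / p) * ∑' i, |g i| ^ p)
              + (p / 2) * ∑' i, (Real.sign (f i) * |f i| ^ (p - 1)
                  - Real.sign (g i) * |g i| ^ (p - 1)) * (f i - g i) := by
  have hp : 0 < p := by linarith
  set K := (((p - 1) / 2) ^ (-(p / 2)) / p) ^ (2 / (2 - p)) with hK
  have hK0 : 0 < K := by
    have : 0 < (p - 1) / 2 := by linarith
    positivity
  refine ⟨2 * p * K, by positivity, fun f g hf hg γ hγ => ?_⟩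
  have hfg := hf.add hg
  have hD : Summable fun i => (Real.sign (f i) * |f i| ^ (p - 1)
      - Real.sign (g i) * |g i| ^ (p - 1)) * (f i - g i) :=
    .of_nonneg_of_le (fun i => bregman_nonneg hp1 (f i) (g i))
      (fun i => bregman_le hp1 (f i) (g i)) (hfg.mul_left 4)
  have hpt := fun i => rpow_abs_sub_le_add_bregman hp1 hp2 hγ (f i) (g i)
  have hR := ((hfg.mul_left (K * γ ^ (2 * p / (2 - p)))).mul_left (1 - p / 2)).add
    (hD.mul_left (p / 2))
  have hL := Summable.of_nonneg_of_le (fun i => by positivity) hpt hR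
  have hsum := hL.tsum_le_tsum hpt hR
  rw [((hfg.mul_left _).mul_left _).tsum_add (hD.mul_left _), tsum_mul_left, tsum_mul_left,
    tsum_mul_left, tsum_mul_left, hf.tsum_add hg, ← hK] at hsum
  refine hsum.trans (add_le_add_left ?_ _)
  set A := ∑' i, |f i| ^ p
  set B := ∑' i, |g i| ^ p
  have hmax : A + B ≤ 2 * p * max (1 / p * A) (1 / p * B) := by
    rw [← mul_max_of_nonneg _ _ (by positivity)]
    have e : 2 * p * (1 / p * max A B) = 2 * max A B := by field_simp
    linarith [le_max_left A B, le_max_right A B]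
  have hp'' : 0 ≤ 1 - p / 2 := by linarith
  calc (1 - p / 2) * (K * γ ^ (2 * p / (2 - p)) * (A + B))
      ≤ (1 - p / 2) * (K * γ ^ (2 * p / (2 - p)) *
          (2 * p * max (1 / p * A) (1 / p * B))) := by gcongr
    _ = _ := by ring
end

section
/- Let F : ℓ² → ℝ be continuous, α > 0, and let (p_n) ⊂ (1,2) be nonincreasing with p_n → 1. Define J_n(c) = F(c) + α R̆_{p_n}(c) and J₁(c) = F(c) + α R̆_1(c), extended-real-valued functionals on ℓ². Suppose that for each n, f_n minimizes J_n over ℓ² (i.e., J_n(f_n) ≤ J_n(h) for all h ∈ ℓ²), and that f_n → f in ℓ²-norm. Then f minimizes J₁ over ℓ², and J_n(f_n) → J₁(f). -/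
open scoped ENNReal

open Filter Topology

lemma ofReal_mul_Rbreve {α r : ℝ} (hα : 0 ≤ α) (hr : 0 ≤ r) (c : ℕ → ℝ) :
    ENNReal.ofReal α * Rbreve r c = ∑' i, ENNReal.ofReal (α * (1 / r) * |c i| ^ r) := by
  rw [Rbreve, ← mul_assoc, ← ENNReal.ofReal_mul hα, ← ENNReal.tsum_mul_left]
  exact tsum_congr fun i => (ENNReal.ofReal_mul (by positivity)).symm

lemma tendsto_ofReal_mul_abs_rpow {ι : Type*} {l : Filter ι} (α : ℝ) {p x : ι → ℝ} {y : ℝ}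
    (hp : Tendsto p l (𝓝 1)) (hx : Tendsto x l (𝓝 y)) :
    Tendsto (fun n => ENNReal.ofReal (α * (1 / p n) * |x n| ^ p n)) l
      (𝓝 (ENNReal.ofReal (α * (1 / 1) * |y| ^ (1 : ℝ)))) := by
  refine ENNReal.tendsto_ofReal (((tendsto_const_nhds.div hp one_ne_zero).const_mul α).mul ?_)
  exact hx.abs.rpow hp (Or.inr one_pos)

/-- Fatou's lemma for series in `ℝ≥0∞`. -/
lemma tsum_le_liminf_tsum {ι β : Type*} {l : Filter ι} [l.NeBot] {g : ι → β → ℝ≥0∞}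
    {G : β → ℝ≥0∞} (h : ∀ i, Tendsto (fun n => g n i) l (𝓝 (G i))) :
    ∑' i, G i ≤ liminf (fun n => ∑' i, g n i) l := by
  rw [ENNReal.tsum_eq_iSup_sum]
  refine iSup_le fun s => ?_
  rw [← (tendsto_finsetSum s fun i _ => h i).liminf_eq]
  exact liminf_le_liminf (Eventually.of_forall fun n => ENNReal.sum_le_tsum s)

lemma rpow_le_add_sq {x r : ℝ} (hx : 0 ≤ x) (h1 : 1 ≤ r) (h2 : r ≤ 2) :
    x ^ r ≤ x + x ^ 2 := by
  rcases le_total x 1 with h | h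
  · have := Real.rpow_le_rpow_of_exponent_ge' hx h zero_le_one h1
    rw [Real.rpow_one] at this
    nlinarith
  · have := Real.rpow_le_rpow_of_exponent_le h h2
    rw [Real.rpow_two] at this
    linarith

lemma Rbreve_le_liminf {ι : Type*} {l : Filter ι} [l.NeBot] {α : ℝ} (hα : 0 ≤ α) {p : ι → ℝ}
    (hp : ∀ n, 0 ≤ p n) (hplim : Tendsto p l (𝓝 1)) {c : ι → ℕ → ℝ} {d : ℕ → ℝ}
    (hc : ∀ i, Tendsto (fun n => c n i) l (𝓝 (d i))) :
    ENNReal.ofReal α * Rbreve 1 d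
      ≤ liminf (fun n => ENNReal.ofReal α * Rbreve (p n) (c n)) l := by
  simp only [ofReal_mul_Rbreve hα zero_le_one, fun n => ofReal_mul_Rbreve hα (hp n) (c n)]
  exact tsum_le_liminf_tsum fun i => tendsto_ofReal_mul_abs_rpow α hplim (hc i)

lemma tendsto_Rbreve {α : ℝ} (hα : 0 ≤ α) {p : ℕ → ℝ} (hp : ∀ n, 1 ≤ p n ∧ p n ≤ 2)
    (hplim : Tendsto p atTop (𝓝 1)) {c : ℕ → ℝ} (hc : Summable fun i => c i ^ 2)
    (hfin : ENNReal.ofReal α * Rbreve 1 c ≠ ∞) :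
    Tendsto (fun n => ENNReal.ofReal α * Rbreve (p n) c) atTop
      (𝓝 (ENNReal.ofReal α * Rbreve 1 c)) := by
  have hp0 : ∀ n, 0 ≤ p n := fun n => zero_le_one.trans (hp n).1
  rw [ofReal_mul_Rbreve hα zero_le_one] at hfin
  simp only [ofReal_mul_Rbreve hα zero_le_one, fun n => ofReal_mul_Rbreve hα (hp0 n) c]
  simp only [← MeasureTheory.lintegral_count]
  refine MeasureTheory.tendsto_lintegral_of_dominated_convergence
    (fun i => ENNReal.ofReal (α * (1 / 1) * |c i| ^ (1 : ℝ)) + ENNReal.ofReal (α * c i ^ 2))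
    (fun n => measurable_of_countable _) (fun n => ?_) ?_ ?_
  · refine Eventually.of_forall fun i => ?_
    beta_reduce
    rw [← ENNReal.ofReal_add (by positivity) (by positivity)]
    refine ENNReal.ofReal_le_ofReal ?_
    have h1 := rpow_le_add_sq (abs_nonneg (c i)) (hp n).1 (hp n).2
    rw [sq_abs] at h1
    have h2 : 1 / p n ≤ 1 := (div_le_one (by linarith [(hp n).1])).2 (hp n).1
    calc α * (1 / p n) * |c i| ^ p n ≤ α * 1 * (|c i| + c i ^ 2) := by gcongr
      _ = _ := by rw [Real.rpow_one]; ring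
  · rw [MeasureTheory.lintegral_count, ENNReal.tsum_add]
    exact ENNReal.add_ne_top.2 ⟨hfin, (hc.mul_left α).tsum_ofReal_ne_top⟩
  · exact Eventually.of_forall fun i =>
      tendsto_ofReal_mul_abs_rpow α hplim tendsto_const_nhds

lemma add_coe_le_liminf {ι : Type*} {l : Filter ι} [l.NeBot] {u : ι → ℝ} {a : ℝ}
    {v : ι → ℝ≥0∞} {b : ℝ≥0∞} (hu : Tendsto u l (𝓝 a)) (hv : b ≤ liminf v l) :
    (a : EReal) + b.toEReal ≤ liminf (fun n => (u n : EReal) + (v n).toEReal) l := by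
  have hu' : liminf (fun n => (u n : EReal)) l = a :=
    ((continuous_coe_real_ereal.tendsto a).comp hu).liminf_eq
  have hv' : (liminf v l).toEReal = liminf (fun n => (v n).toEReal) l :=
    (EReal.coe_ennreal_strictMono.monotone).map_liminf_of_continuousAt v
      continuous_coe_ennreal_ereal.continuousAt
  calc (a : EReal) + b.toEReal
      ≤ liminf (fun n => (u n : EReal)) l + liminf (fun n => (v n).toEReal) l := by
        rw [hu', ← hv']
        gcongr
        exact EReal.coe_ennreal_strictMono.monotone hv
    _ ≤ _ := EReal.le_liminf_add

/-- consequence of Theorem 5.2, used for Corollary 5.3.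
Let `F : ℓ² → ℝ` be continuous, `α > 0`, `(p n) ⊂ (1,2)` nonincreasing with `p n → 1`.
Set `J_n(c) = F(c) + α R̆_{p_n}(c)` and `J₁(c) = F(c) + α R̆_1(c)` (extended-real-valued).
If each `fseq n` minimizes `J_n` over `ℓ²` and `fseq n → f` in `ℓ²`-norm, then `f`
minimizes `J₁` over `ℓ²` and `J_n(fseq n) → J₁(f)`. -/
theorem stmt12 (F : lp (fun _ : ℕ => ℝ) 2 → ℝ) (hF : Continuous F)
    (α : ℝ) (hα : 0 < α)
    (p : ℕ → ℝ) (hmono : Antitone p) (hp : ∀ n, 1 < p n ∧ p n < 2)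
    (hplim : Filter.Tendsto p Filter.atTop (nhds 1))
    (fseq : ℕ → lp (fun _ : ℕ => ℝ) 2) (f : lp (fun _ : ℕ => ℝ) 2)
    (hmin : ∀ (n : ℕ) (h : lp (fun _ : ℕ => ℝ) 2),
      ((F (fseq n) : EReal) + (ENNReal.ofReal α * Rbreve (p n) (fun i => fseq n i)).toEReal)
        ≤ ((F h : EReal) + (ENNReal.ofReal α * Rbreve (p n) (fun i => h i)).toEReal))
    (hconv : Filter.Tendsto fseq Filter.atTop (nhds f)) :
    (∀ h : lp (fun _ : ℕ => ℝ) 2,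
      ((F f : EReal) + (ENNReal.ofReal α * Rbreve 1 (fun i => f i)).toEReal)
        ≤ ((F h : EReal) + (ENNReal.ofReal α * Rbreve 1 (fun i => h i)).toEReal)) ∧
    Filter.Tendsto
      (fun n => (F (fseq n) : EReal)
        + (ENNReal.ofReal α * Rbreve (p n) (fun i => fseq n i)).toEReal)
      Filter.atTop
      (nhds ((F f : EReal) + (ENNReal.ofReal α * Rbreve 1 (fun i => f i)).toEReal)) := by
  have h2 : ∀ n, 1 ≤ p n ∧ p n ≤ 2 := fun n => ⟨(hp n).1.le, (hp n).2.le⟩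
  have hcoord : ∀ i, Tendsto (fun n => fseq n i) atTop (𝓝 (f i)) := fun i =>
    ((continuous_apply i).comp (lp.uniformContinuous_coe (p := 2)).continuous).continuousAt.tendsto.comp
      hconv
  have hlow := add_coe_le_liminf ((hF.tendsto f).comp hconv)
    (Rbreve_le_liminf hα.le (fun n => zero_le_one.trans (h2 n).1) hplim hcoord)
  have hup : ∀ h : lp (fun _ : ℕ => ℝ) 2,
      limsup (fun n => (F (fseq n) : EReal)
        + (ENNReal.ofReal α * Rbreve (p n) (fun i => fseq n i)).toEReal) atTop
      ≤ (F h : EReal) + (ENNReal.ofReal α * Rbreve 1 (fun i => h i)).toEReal := by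
    intro h
    by_cases hfin : ENNReal.ofReal α * Rbreve 1 (fun i => h i) = ∞
    · rw [hfin, EReal.coe_ennreal_top, EReal.coe_add_top]
      exact le_top
    · have hsum : Summable fun i => h i ^ 2 := by
        simpa using (lp.memℓp h).summable (by norm_num)
      have hlim := (continuous_coe_ennreal_ereal.tendsto _).comp
        (tendsto_Rbreve hα.le h2 hplim hsum hfin)
      have hadd := (EReal.continuousAt_add (p := ((F h : EReal), _))
        (Or.inl (EReal.coe_ne_top _)) (Or.inl (EReal.coe_ne_bot _))).tendsto.comp
        ((tendsto_const_nhds (x := (F h : EReal))).prodMk_nhds hlim)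
      refine le_trans ?_ hadd.limsup_eq.le
      exact limsup_le_limsup (Eventually.of_forall fun n => hmin n h)
  exact ⟨fun h => hlow.trans ((liminf_le_limsup).trans (hup h)),
    tendsto_of_le_liminf_of_limsup_le hlow (hup f)⟩
end
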